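/- Fix an integer q ≥ 1, integers m_i ≥ 1, a real number β, covariates x_{ij} ∈ ℝ, and responses y_{ij} ∈ {0, 1} for j = 1, …, m_i, i = 1, …, q; set y_{i+} = Σ_{j=1}^{m_i} y_{ij}. Define r(u) = exp{ Σ_{i=1}^q [ u_i y_{i+} − Σ_{j=1}^{m_i} log(1 + e^{β x_{ij} + u_i}) ] } for u ∈ ℝ^q. Then r(u) ≤ exp{ −β Σ_{i=1}^q Σ_{j=1}^{m_i} x_{ij} y_{ij} } for all u ∈ ℝ^q; that is, r is bounded above on ℝ^q. Consequently the Metropolis–Hastings independence sampler for the logit-normal GLMM target π(u | y; θ), with proposals drawn from the random effects' marginal distribution N_q(0, σ² I), is uniformly ergodic. -/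

import Mathlib

open MeasureTheory ProbabilityTheory
open scoped ENNReal

/-- The `n`-step Markov transition kernel, obtained by iterated composition of `P`. -/
noncomputable def kIter {X : Type*} [MeasurableSpace X] (P : Kernel X X) : ℕ → Kernel X X
  | 0 => Kernel.id
  | n + 1 => (kIter P n) ∘ₖ P

/-- Uniform ergodicity: geometric convergence in total variation, uniformly in the
starting point. -/
def UnifErgodic {Y : Type*} [MeasurableSpace Y] (P : Kernel Y Y) (π : Measure Y) : Prop :=
  ∃ C t : ℝ, 0 ≤ C ∧ 0 ≤ t ∧ t < 1 ∧
    ∀ (n : ℕ) (x : Y) (A : Set Y), MeasurableSet A →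
      |(kIter P n x A).toReal - (π A).toReal| ≤ C * t ^ n

/-- The target/proposal density ratio for the logit-normal GLMM independence sampler:
`r(u) = exp{ Σ_i [ u_i y_{i+} − Σ_j log(1 + e^{β x_{ij} + u_i}) ] }`. -/
noncomputable def glmmRatio (q : ℕ) (mi : Fin q → ℕ) (β : ℝ)
    (x y : ∀ i : Fin q, Fin (mi i) → ℝ) : (Fin q → ℝ) → ℝ :=
  fun u => Real.exp (∑ i, (u i * (∑ j, y i j) -
    ∑ j, Real.log (1 + Real.exp (β * x i j + u i))))

/-- The `N_q(0, σ² I)` proposal density. -/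
noncomputable def gaussProp (q : ℕ) (σ2 : ℝ) : (Fin q → ℝ) → ℝ :=
  fun u => (2 * Real.pi * σ2) ^ (-(q : ℝ) / 2) *
    Real.exp (-(∑ i, u i ^ 2) / (2 * σ2))

/-- The target density `π(u | y; θ) ∝ r(u) exp{-Σ u_i²/(2σ²)}` of the random effects
given the data in the logit-normal GLMM. -/
noncomputable def glmmTarget (q : ℕ) (mi : Fin q → ℕ) (β σ2 : ℝ)
    (x y : ∀ i : Fin q, Fin (mi i) → ℝ) (cπ : ℝ) : (Fin q → ℝ) → ℝ :=
  fun u => cπ * glmmRatio q mi β x y u * Real.exp (-(∑ i, u i ^ 2) / (2 * σ2))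

/-- A kernel that moves according to the sub-Markov density `w` and otherwise stays put leaves
`f • μ` invariant as soon as `w` is in detailed balance with `f`. -/
lemma invariant_of_detailedBalance {X : Type*} [MeasurableSpace X] {μ : Measure X} [SFinite μ]
    {f : X → ℝ≥0∞} (hf : Measurable f) {w : X → X → ℝ≥0∞} (hw : Measurable (Function.uncurry w))
    (hsymm : ∀ u v, f u * w u v = f v * w v u)
    {P : Kernel X X} [IsMarkovKernel P]
    (hP : ∀ (u : X) (S : Set X), MeasurableSet S →
      P u S = (∫⁻ v in S, w u v ∂μ) + (1 - ∫⁻ v, w u v ∂μ) * S.indicator 1 u) :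
    P.Invariant (μ.withDensity f) := by
  have hA : ∀ u, ∫⁻ v, w u v ∂μ ≤ 1 := by
    intro u
    have h := hP u Set.univ .univ
    simp only [measure_univ, Measure.restrict_univ, Set.indicator_univ, Pi.one_apply,
      mul_one] at h
    exact h ▸ le_self_add
  have hAm : Measurable fun u => ∫⁻ v, w u v ∂μ := hw.lintegral_prod_right'
  have hwu : ∀ u, Measurable (w u) := fun u => hw.comp measurable_prodMk_left
  refine Measure.ext fun S hS => ?_
  have hSm : Measurable fun u => ∫⁻ v in S, w u v ∂μ := hw.lintegral_prod_right'
  have hmove : ∫⁻ u, f u * ∫⁻ v in S, w u v ∂μ ∂μ = ∫⁻ v in S, f v * ∫⁻ u, w v u ∂μ ∂μ := by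
    simp_rw [← lintegral_const_mul _ (hwu _)]
    rw [lintegral_lintegral_swap]
    · simp_rw [hsymm]
    · exact ((hf.comp measurable_fst).mul hw).aemeasurable
  rw [Measure.bind_apply hS P.measurable.aemeasurable,
    lintegral_withDensity_eq_lintegral_mul _ hf (P.measurable_coe hS), withDensity_apply _ hS]
  simp only [Pi.mul_apply, hP _ S hS, mul_add]
  rw [lintegral_add_left (hf.fun_mul hSm), hmove]
  have hstay : ∫⁻ u, f u * ((1 - ∫⁻ v, w u v ∂μ) * S.indicator 1 u) ∂μ
      = ∫⁻ u in S, f u * (1 - ∫⁻ v, w u v ∂μ) ∂μ := by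
    rw [← lintegral_indicator hS]
    refine lintegral_congr fun u => ?_
    by_cases hu : u ∈ S <;> simp [hu]
  rw [hstay, ← lintegral_add_left (hf.fun_mul hAm)]
  refine lintegral_congr fun u => ?_
  rw [← mul_add, add_tsub_cancel_of_le (hA u), mul_one]

instance isMarkovKernel_kIter {X : Type*} [MeasurableSpace X] (P : Kernel X X) [IsMarkovKernel P]
    (n : ℕ) : IsMarkovKernel (kIter P n) := by
  induction n with
  | zero => exact inferInstanceAs (IsMarkovKernel Kernel.id)
  | succ n ih => exact inferInstanceAs (IsMarkovKernel (kIter P n ∘ₖ P))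

lemma invariant_kIter {X : Type*} [MeasurableSpace X] {P : Kernel X X} {π : Measure X}
    (h : P.Invariant π) (n : ℕ) : (kIter P n).Invariant π := by
  induction n with
  | zero => exact Measure.bind_dirac
  | succ n ih => exact ih.comp h

/-- Doeblin's theorem: a Markov kernel whose transition laws all dominate a fixed multiple of an
invariant probability measure is uniformly ergodic. -/
lemma unifErgodic_of_minorization {X : Type*} [MeasurableSpace X] {P : Kernel X X}
    [IsMarkovKernel P] {π : Measure X} [IsProbabilityMeasure π] (hinv : P.Invariant π)
    {ε : ℝ} (hε : 0 < ε) (hmin : ∀ x, ENNReal.ofReal ε • π ≤ P x) :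
    UnifErgodic P π := by
  obtain ⟨x₀⟩ : Nonempty X := nonempty_of_isProbabilityMeasure π
  have hε1 : ε ≤ 1 := by
    simpa using hmin x₀ Set.univ
  refine ⟨1, 1 - ε, zero_le_one, by linarith, by linarith, fun n x A hA => ?_⟩
  simp only [one_mul, ← measureReal_def]
  have hmeas : ∀ n, Measurable fun y => (kIter P n y).real A := fun n =>
    ((kIter P n).measurable_coe hA).ennreal_toReal
  have hint : ∀ n (μ : Measure X) [IsProbabilityMeasure μ],
      Integrable (fun y => (kIter P n y).real A) μ := fun n μ _ =>
    .of_bound (hmeas n).aestronglyMeasurable 1 (.of_forall fun y => by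
      simp [abs_of_nonneg measureReal_nonneg, measureReal_le_one])
  have hmean : ∀ n, ∫ y, (kIter P n y).real A ∂π = π.real A := by
    intro n
    simp only [measureReal_def]
    rw [integral_toReal ((kIter P n).measurable_coe hA).aemeasurable
      (.of_forall fun y => measure_lt_top _ _),
      ← Measure.bind_apply hA (kIter P n).measurable.aemeasurable, (invariant_kIter hinv n).def]
  induction n generalizing x with
  | zero =>
    rw [pow_zero, abs_le]
    constructor <;>
    linarith [measureReal_nonneg (μ := π) (s := A), measureReal_le_one (μ := π) (s := A),
      measureReal_nonneg (μ := kIter P 0 x) (s := A), measureReal_le_one (μ := kIter P 0 x) (s := A)]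
  | succ n ih =>
    have hstep : (kIter P (n + 1) x).real A = ∫ y, (kIter P n y).real A ∂(P x) := by
      simp only [measureReal_def]
      rw [integral_toReal ((kIter P n).measurable_coe hA).aemeasurable
        (.of_forall fun y => measure_lt_top _ _), ← Kernel.comp_apply' _ _ _ hA]
      rfl
    have hdom : ∀ g : X → ℝ, (∀ y, 0 ≤ g y) → Integrable g (P x) →
        ε * ∫ y, g y ∂π ≤ ∫ y, g y ∂(P x) := by
      intro g hg hgi
      have h := integral_mono_measure (hmin x) (.of_forall hg) hgi
      rwa [integral_smul_measure, ENNReal.toReal_ofReal hε.le, smul_eq_mul] at h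
    have hupper := hdom (fun y => ((1 - ε) ^ n + π.real A) - (kIter P n y).real A)
      (fun y => by linarith [(abs_le.1 (ih y)).2]) ((integrable_const _).sub (hint n _))
    have hlower := hdom (fun y => (kIter P n y).real A - (π.real A - (1 - ε) ^ n))
      (fun y => by linarith [(abs_le.1 (ih y)).1]) ((hint n _).sub (integrable_const _))
    rw [integral_sub (integrable_const _) (hint n _), integral_sub (integrable_const _) (hint n _),
      hmean, ← hstep] at hupper
    rw [integral_sub (hint n _) (integrable_const _), integral_sub (hint n _) (integrable_const _),
      hmean, ← hstep] at hlower
    simp only [integral_const, probReal_univ, one_smul] at hupper hlower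
    rw [abs_le, pow_succ]
    constructor <;> linarith

lemma glmmRatio_pos (q : ℕ) (mi : Fin q → ℕ) (β : ℝ) (x y : ∀ i : Fin q, Fin (mi i) → ℝ)
    (u : Fin q → ℝ) : 0 < glmmRatio q mi β x y u :=
  Real.exp_pos _

lemma glmmRatio_le (q : ℕ) (mi : Fin q → ℕ) (β : ℝ) (x y : ∀ i : Fin q, Fin (mi i) → ℝ)
    (hy : ∀ i j, y i j = 0 ∨ y i j = 1) (u : Fin q → ℝ) :
    glmmRatio q mi β x y u ≤ Real.exp (-β * ∑ i, ∑ j, x i j * y i j) := by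
  refine Real.exp_le_exp.2 ?_
  simp only [Finset.mul_sum, ← Finset.sum_sub_distrib]
  refine Finset.sum_le_sum fun i _ => Finset.sum_le_sum fun j _ => ?_
  have hlog : ∀ z : ℝ, 0 ≤ Real.log (1 + Real.exp z) ∧ z ≤ Real.log (1 + Real.exp z) := fun z =>
    ⟨Real.log_nonneg (by linarith [Real.exp_pos z]),
      (Real.le_log_iff_exp_le (by positivity)).2 (by linarith)⟩
  obtain ⟨h0, h1⟩ := hlog (β * x i j + u i)
  rcases hy i j with h | h <;> rw [h] <;> linarith

lemma measurable_glmmTarget (q : ℕ) (mi : Fin q → ℕ) (β σ2 : ℝ)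
    (x y : ∀ i : Fin q, Fin (mi i) → ℝ) (cπ : ℝ) : Measurable (glmmTarget q mi β σ2 x y cπ) := by
  unfold glmmTarget glmmRatio
  fun_prop

lemma measurable_gaussProp (q : ℕ) (σ2 : ℝ) : Measurable (gaussProp q σ2) := by
  unfold gaussProp
  fun_prop

lemma glmmTarget_pos (q : ℕ) (mi : Fin q → ℕ) (β σ2 : ℝ) (x y : ∀ i : Fin q, Fin (mi i) → ℝ)
    {cπ : ℝ} (hcπ : 0 < cπ) (u : Fin q → ℝ) : 0 < glmmTarget q mi β σ2 x y cπ u :=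
  mul_pos (mul_pos hcπ (glmmRatio_pos q mi β x y u)) (Real.exp_pos _)

lemma gaussProp_pos (q : ℕ) {σ2 : ℝ} (hσ2 : 0 < σ2) (u : Fin q → ℝ) : 0 < gaussProp q σ2 u := by
  unfold gaussProp
  positivity

/-- The target density is at most a constant multiple of the proposal density. -/
lemma exists_mul_glmmTarget_le_gaussProp (q : ℕ) (mi : Fin q → ℕ) (β : ℝ) {σ2 : ℝ} (hσ2 : 0 < σ2)
    (x y : ∀ i : Fin q, Fin (mi i) → ℝ) (hy : ∀ i j, y i j = 0 ∨ y i j = 1)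
    {cπ : ℝ} (hcπ : 0 < cπ) :
    ∃ ε > 0, ∀ u, ε * glmmTarget q mi β σ2 x y cπ u ≤ gaussProp q σ2 u := by
  set M := Real.exp (-β * ∑ i, ∑ j, x i j * y i j)
  have hMpos : 0 < M := Real.exp_pos _
  refine ⟨(2 * Real.pi * σ2) ^ (-(q : ℝ) / 2) / (cπ * M), by positivity, fun u => ?_⟩
  unfold glmmTarget gaussProp
  rw [← mul_assoc]
  gcongr
  rw [div_mul_eq_mul_div, div_le_iff₀ (by positivity)]
  gcongr
  exact glmmRatio_le q mi β x y hy u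

/-- Weighted by the target density, the Metropolis–Hastings acceptance density becomes a minimum of
products, from which detailed balance is evident. -/
lemma mul_min_one_div_mul {a b p r : ℝ} (ha : 0 < a) (hr : 0 < r) :
    a * (min 1 (b * p / (a * r)) * r) = min (a * r) (b * p) := by
  have har := mul_pos ha hr
  rw [mul_comm _ r, ← mul_assoc, mul_min_of_nonneg _ _ har.le, mul_one, mul_div_cancel₀ _ har.ne']

/-- In the logit-normal GLMM, the target/proposal ratio satisfies
`r(u) ≤ exp{-β Σ_i Σ_j x_{ij} y_{ij}}` for all `u ∈ ℝ^q`, i.e. `r` is bounded;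
consequently the Metropolis–Hastings independence sampler with `N_q(0, σ² I)` proposals
targeting `π(u | y; θ)` is uniformly ergodic. -/
theorem glmm_MHIS_uniformly_ergodic
    (q : ℕ) (hq : 1 ≤ q) (mi : Fin q → ℕ) (hmi : ∀ i, 1 ≤ mi i)
    (β σ2 : ℝ) (hσ2 : 0 < σ2)
    (x y : ∀ i : Fin q, Fin (mi i) → ℝ) (hy : ∀ i j, y i j = 0 ∨ y i j = 1)
    (cπ : ℝ) (hcπ : 0 < cπ)
    (hTargetProb : IsProbabilityMeasure
      (volume.withDensity fun u => ENNReal.ofReal (glmmTarget q mi β σ2 x y cπ u)))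
    -- `P` is the Metropolis–Hastings independence sampler kernel
    (P : Kernel (Fin q → ℝ) (Fin q → ℝ)) [IsMarkovKernel P]
    (hP : ∀ (u : Fin q → ℝ) (S : Set (Fin q → ℝ)), MeasurableSet S →
      P u S = (∫⁻ v in S,
          ENNReal.ofReal (min 1 ((glmmTarget q mi β σ2 x y cπ v * gaussProp q σ2 u) /
            (glmmTarget q mi β σ2 x y cπ u * gaussProp q σ2 v))) *
            ENNReal.ofReal (gaussProp q σ2 v)) +
        (1 - ∫⁻ v, ENNReal.ofReal (min 1 ((glmmTarget q mi β σ2 x y cπ v *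
              gaussProp q σ2 u) /
            (glmmTarget q mi β σ2 x y cπ u * gaussProp q σ2 v))) *
            ENNReal.ofReal (gaussProp q σ2 v)) * S.indicator 1 u) :
    (∀ u : Fin q → ℝ,
        glmmRatio q mi β x y u ≤ Real.exp (-β * ∑ i, ∑ j, x i j * y i j)) ∧
    UnifErgodic P
      (volume.withDensity fun u => ENNReal.ofReal (glmmTarget q mi β σ2 x y cπ u)) := by
  refine ⟨glmmRatio_le q mi β x y hy, ?_⟩
  set f := glmmTarget q mi β σ2 x y cπ
  set p := gaussProp q σ2
  have hf : Measurable f := measurable_glmmTarget q mi β σ2 x y cπ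
  have hp : Measurable p := measurable_gaussProp q σ2
  have hfpos : ∀ u, 0 < f u := glmmTarget_pos q mi β σ2 x y hcπ
  have hppos : ∀ u, 0 < p u := gaussProp_pos q hσ2
  obtain ⟨ε, hε, hle⟩ : ∃ ε > 0, ∀ u, ε * f u ≤ p u :=
    exists_mul_glmmTarget_le_gaussProp q mi β hσ2 x y hy hcπ
  have hinv : P.Invariant (volume.withDensity fun u => ENNReal.ofReal (f u)) := by
    refine invariant_of_detailedBalance hf.ennreal_ofReal ?_ (fun u v => ?_) hP
    · unfold Function.uncurry
      fun_prop
    · have hpos : ∀ a b : Fin q → ℝ, 0 ≤ min 1 (f b * p a / (f a * p b)) := fun a b =>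
        le_min zero_le_one (div_nonneg (mul_pos (hfpos b) (hppos a)).le
          (mul_pos (hfpos a) (hppos b)).le)
      rw [← ENNReal.ofReal_mul (hpos u v), ← ENNReal.ofReal_mul (hpos v u),
        ← ENNReal.ofReal_mul (hfpos u).le, ← ENNReal.ofReal_mul (hfpos v).le,
        mul_min_one_div_mul (hfpos u) (hppos v), mul_min_one_div_mul (hfpos v) (hppos u), min_comm]
  refine unifErgodic_of_minorization hinv hε fun u => Measure.le_iff.2 fun S hS => ?_
  rw [Measure.smul_apply, smul_eq_mul, withDensity_apply _ hS, hP u S hS,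
    ← lintegral_const_mul _ hf.ennreal_ofReal]
  refine le_add_right (lintegral_mono fun v => ?_)
  rw [← ENNReal.ofReal_mul hε.le, ← ENNReal.ofReal_mul' (hppos v).le]
  refine ENNReal.ofReal_le_ofReal (le_of_mul_le_mul_left ?_ (hfpos u))
  rw [mul_min_one_div_mul (hfpos u) (hppos v), le_min_iff]
  exact ⟨mul_le_mul_of_nonneg_left (hle v) (hfpos u).le,
    by nlinarith [mul_le_mul_of_nonneg_left (hle u) (hfpos v).le]⟩
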